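/- Let p be a prime, q = p^f, and K = 𝔽_q((ϖ)) the field of formal Laurent series over the finite field 𝔽_q with q elements, with ring of integers 𝔬 = 𝔽_q[[ϖ]]. Then the image of 𝔬 under the quotient map K → K/℘(K) is a subgroup of order exactly p; equivalently, the quotient group (𝔬 + ℘(K))/℘(K) has exactly p elements. -/

import Mathlib

noncomputable def asSol {F : Type*} [Field F] (p : ℕ) (hp : 1 < p) (g : PowerSeries F) : ℕ → F
  | 0 => 0
  | (n + 1) => (if p ∣ n + 1 then (asSol p hp g ((n + 1) / p)) ^ p else 0)
      - PowerSeries.coeff (n + 1) g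
  decreasing_by exact Nat.div_lt_self (Nat.succ_pos n) hp

lemma asSol_spec {F : Type*} [Field F] (p : ℕ) [hp : Fact p.Prime] [CharP F p]
    (g : PowerSeries F) (hg : PowerSeries.coeff 0 g = 0) :
    ∃ h : PowerSeries F, h ^ p - h = g := by
  refine ⟨PowerSeries.mk (asSol p hp.out.one_lt g), ?_⟩
  have key : ∀ h : PowerSeries F, h ^ p =
      PowerSeries.map (frobenius F p) (PowerSeries.expand p hp.out.ne_zero h) := fun h =>
    (MvPowerSeries.map_frobenius_expand (σ := Unit) (R := F) p hp.out.ne_zero (f := h)).symm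
  ext n
  rw [key, map_sub, PowerSeries.coeff_map, PowerSeries.coeff_expand, PowerSeries.coeff_mk,
    PowerSeries.coeff_mk, frobenius_def]
  cases n with
  | zero => simp [asSol, hg, hp.out.ne_zero]
  | succ n =>
    rw [asSol]
    split_ifs
    · ring
    · simp [hp.out.ne_zero]

lemma laurent_integral {F : Type*} [Field F] (p : ℕ) [hp : Fact p.Prime]
    (c : PowerSeries F) (y : LaurentSeries F) (h : (c : LaurentSeries F) = y ^ p - y) :
    ∃ g : PowerSeries F, (g : LaurentSeries F) = y := by
  have h2 := hp.out.two_le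
  have hord : 0 ≤ y.order := by
    by_contra! hneg
    have hy : y ≠ 0 := by rintro rfl; simp at hneg
    have hpo : (y ^ p).order = (p : ℤ) * y.order := by
      rw [HahnSeries.order_pow]; simp
    have hlt : (p : ℤ) * y.order < y.order := by
      have : (2 : ℤ) ≤ p := by exact_mod_cast h2
      nlinarith
    have h1 := congrArg (fun z : LaurentSeries F => z.coeff ((p : ℤ) * y.order)) h
    simp only [HahnSeries.coeff_sub] at h1
    rw [PowerSeries.coeff_coe, if_pos (by linarith), HahnSeries.coeff_eq_zero_of_lt_order hlt,
      sub_zero, ← hpo] at h1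
    exact pow_ne_zero p hy (HahnSeries.coeff_order_eq_zero.1 h1.symm)
  refine ⟨PowerSeries.mk fun n => y.coeff n, ?_⟩
  ext i
  rw [PowerSeries.coeff_coe]
  split_ifs with hi
  · exact (HahnSeries.coeff_eq_zero_of_lt_order (lt_of_lt_of_le hi hord)).symm
  · rw [PowerSeries.coeff_mk, Int.natAbs_of_nonneg (not_lt.1 hi)]


/-- **The image of `𝔬` in `K/℘(K)` has order `p` for `K = 𝔽_q((ϖ))`.**
Let `p` be a prime, `q = p^f`, `K = 𝔽_q((ϖ))` the field of formal Laurent series over the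
finite field with `q` elements, with ring of integers `𝔬 = 𝔽_q[[ϖ]]`.  Let `W = ℘(K)` be
the additive subgroup `{y^p - y : y ∈ K}` and `O` the additive subgroup of `K` given by
the image of `𝔬`.  Then the image of `O` under the quotient map `K → K/℘(K)`, i.e. the
group `(𝔬 + ℘(K))/℘(K)`, has exactly `p` elements. -/
theorem image_of_integers_in_artin_schreier_quotient_card
    (p f : ℕ) [hp : Fact p.Prime] (hf : f ≠ 0)
    (F : Type*) [Field F] [Fintype F] (hcard : Fintype.card F = p ^ f)
    (W : AddSubgroup (LaurentSeries F))
    (hW : (W : Set (LaurentSeries F)) = Set.range (fun y : LaurentSeries F => y ^ p - y))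
    (O : AddSubgroup (LaurentSeries F))
    (hO : (O : Set (LaurentSeries F)) =
      Set.range (fun g : PowerSeries F => (g : LaurentSeries F))) :
    Nat.card (AddSubgroup.map (QuotientAddGroup.mk' W) O) = p := by
  haveI : CharP F p := charP_of_card_eq_prime_pow hcard
  have hWm : ∀ x, x ∈ W ↔ ∃ y : LaurentSeries F, y ^ p - y = x := fun x => by
    rw [← SetLike.mem_coe, hW]; rfl
  have hOm : ∀ x, x ∈ O ↔ ∃ g : PowerSeries F, (g : LaurentSeries F) = x := fun x => by
    rw [← SetLike.mem_coe, hO]; rfl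
  let P : F →+ F := (frobenius F p).toAddMonoidHom - AddMonoidHom.id F
  have hP : ∀ x, P x = x ^ p - x := fun x => rfl
  let ι : F →+ LaurentSeries F :=
    ((HahnSeries.ofPowerSeries ℤ F).comp (PowerSeries.C (R := F))).toAddMonoidHom
  have hι : ∀ x, ι x = ((PowerSeries.C x : PowerSeries F) : LaurentSeries F) := fun x => rfl
  let φ : F →+ LaurentSeries F ⧸ W := (QuotientAddGroup.mk' W).comp ι
  have hφ : ∀ x, φ x = QuotientAddGroup.mk' W (ι x) := fun x => rfl
  have hrange : AddSubgroup.map (QuotientAddGroup.mk' W) O = φ.range := by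
    ext z
    constructor
    · rintro ⟨x, hx, rfl⟩
      obtain ⟨g, rfl⟩ := (hOm x).1 hx
      refine ⟨PowerSeries.coeff 0 g, ?_⟩
      obtain ⟨h, hh⟩ := asSol_spec p (g - PowerSeries.C (PowerSeries.coeff 0 g)) (by simp)
      rw [hφ]
      refine (QuotientAddGroup.mk'_eq_mk' W).2 ⟨_, (hWm _).2 ⟨(h : LaurentSeries F), rfl⟩, ?_⟩
      rw [hι, ← map_pow, ← map_sub, hh, map_sub]
      abel
    · rintro ⟨c, rfl⟩
      exact ⟨ι c, (hOm _).2 ⟨_, rfl⟩, rfl⟩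
  have hker : φ.ker = P.range := by
    ext c
    rw [AddMonoidHom.mem_ker, hφ, QuotientAddGroup.mk'_apply, QuotientAddGroup.eq_zero_iff, hWm]
    constructor
    · rintro ⟨y, hy⟩
      obtain ⟨g, rfl⟩ := laurent_integral p (PowerSeries.C c) y (by rw [hy, hι])
      rw [hι, ← map_pow, ← map_sub] at hy
      have h3 := HahnSeries.ofPowerSeries_injective hy
      refine ⟨PowerSeries.constantCoeff g, ?_⟩
      have := congrArg (PowerSeries.constantCoeff (R := F)) h3
      simpa [hP] using this
    · rintro ⟨a, rfl⟩
      refine ⟨ι a, ?_⟩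
      simp only [hι, hP, map_sub, map_pow]
  have hPker : Nat.card P.ker = p := by
    rw [← Subfield.card_bot F p]
    refine Nat.card_congr (Equiv.subtypeEquivRight fun x => ?_)
    rw [AddMonoidHom.mem_ker, hP, sub_eq_zero, Subfield.mem_bot_iff_pow_eq_self F p]
  rw [hrange]
  have e1 := φ.ker.card_mul_index
  have e2 := P.ker.card_mul_index
  rw [AddSubgroup.index_ker, hker] at e1
  rw [AddSubgroup.index_ker, hPker] at e2
  have hpos : 0 < Nat.card P.range := Nat.card_pos
  refine Nat.eq_of_mul_eq_mul_left hpos ?_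
  rw [e1, ← e2, mul_comm]
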